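/- Let p be an odd prime, n an even positive integer, s a positive integer with s ≤ n/2, and ε ∈ {1,−1}. Let {A_i : i ∈ V_s} be a partition of V_n into nonempty sets and let F : V_n → V_s be the function with F(x) = i if and only if x ∈ A_i. Then the following are equivalent. (1) The partition is a bent partition satisfying Condition C with sign ε, i.e.: (a) a•A_i = A_i for every a ∈ (ZMod p)ˣ and every i ∈ V_s, and (b) for every g : V_s → ZMod p each of whose fibers has exactly p^{s−1} elements, g ∘ F is weakly regular bent with sign ε. (2) F is a vectorial dual-bent function satisfying Condition A with sign ε. -/

import Mathlib

open Finset

/-- `ζ_p^t = exp(2πi·t.val/p)` for `t : ZMod p`. -/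
noncomputable def zetaP (p : ℕ) (t : ZMod p) : ℂ :=
  Complex.exp (2 * Real.pi * Complex.I * (t.val : ℂ) / (p : ℂ))

/-- The standard inner product on `V_n = Fin n → ZMod p`. -/
def ip {p n : ℕ} (a x : Fin n → ZMod p) : ZMod p := ∑ i, a i * x i

/-- The Walsh transform of `f : V_n → ZMod p`. -/
noncomputable def walsh {p n : ℕ} [NeZero p] (f : (Fin n → ZMod p) → ZMod p)
    (a : Fin n → ZMod p) : ℂ :=
  ∑ x : Fin n → ZMod p, zetaP p (f x - ip a x)

/-- `f : V_n → ZMod p` is weakly regular bent with sign `ε`. -/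
def WeaklyRegularBent {n : ℕ} (p : ℕ) [NeZero p]
    (f : (Fin n → ZMod p) → ZMod p) (ε : ℤ) : Prop :=
  ∃ fd : (Fin n → ZMod p) → ZMod p,
    ∀ a : Fin n → ZMod p, walsh f a = (ε : ℂ) * (p : ℂ) ^ (n / 2) * zetaP p (fd a)

/-- `F : V_n → V_s` is a vectorial dual-bent function satisfying Condition A with sign `ε`. -/
def ConditionA {n s : ℕ} (p : ℕ) [NeZero p]
    (F : (Fin n → ZMod p) → (Fin s → ZMod p)) (ε : ℤ) : Prop :=
  ∃ Fd : (Fin n → ZMod p) → (Fin s → ZMod p),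
    ∀ c : Fin s → ZMod p, c ≠ 0 → ∀ a : Fin n → ZMod p,
      walsh (fun x => ip c (F x)) a = (ε : ℂ) * (p : ℂ) ^ (n / 2) * zetaP p (ip c (Fd a))

theorem zetaP_eq_stdAddChar (p : ℕ) [NeZero p] (t : ZMod p) :
    zetaP p t = ZMod.stdAddChar t := by
  rw [ZMod.stdAddChar_apply, ZMod.toCircle_apply, zetaP]

theorem exists_eq_add_indicator_of_row_sums {ι : Type*} [Fintype ι] [DecidableEq ι] {p k : ℕ}
    (hp : 3 ≤ p) (hk : 0 < k) (hcard : Fintype.card ι = p * k) (T : ι → ℚ) (C : ℚ)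
    (H : ∀ e : Fin p × Fin k ≃ ι, ∃ j₀, ∀ j, ∑ t, T (e (j, t)) = C + if j = j₀ then 1 else 0) :
    ∃ i₀ v, ∀ i, T i = v + if i = i₀ then 1 else 0 := by
  let e₁ : Fin (p * k) ≃ ι := (Fintype.equivFinOfCardEq hcard).symm
  let e : Fin p × Fin k ≃ ι := (finProdFinEquiv.trans (Tuple.sort (T ∘ e₁))).trans e₁
  have hmono : ∀ a b, finProdFinEquiv a ≤ finProdFinEquiv b → T (e a) ≤ T (e b) :=
    fun a b hab => Tuple.monotone_sort (T ∘ e₁) hab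
  have hrow : ∀ i j : Fin p, i < j → ∀ t t' : Fin k, T (e (i, t)) ≤ T (e (j, t')) := by
    intro i j hij t t'
    apply hmono
    rw [Fin.le_def]
    simp only [finProdFinEquiv_apply_val]
    have h1 : (i : ℕ) + 1 ≤ j := hij
    have h2 := Nat.mul_le_mul_left k h1
    have h3 := t.2
    rw [mul_add] at h2
    omega
  have hcol : ∀ (j : Fin p) (t t' : Fin k), t ≤ t' → T (e (j, t)) ≤ T (e (j, t')) := by
    intro j t t' h
    apply hmono
    rw [Fin.le_def]
    simpa [finProdFinEquiv_apply_val] using h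
  let z : Fin p := ⟨0, by omega⟩
  let o : Fin p := ⟨1, by omega⟩
  let l : Fin p := ⟨p - 1, by omega⟩
  let t₀ : Fin k := ⟨0, hk⟩
  have hl : ∀ j, j ≠ l → j < l := by
    intro j hj
    rw [Fin.lt_def]
    have : (j : ℕ) ≠ p - 1 := fun h => hj (Fin.ext h)
    have := j.2
    change (j : ℕ) < p - 1
    omega
  obtain ⟨j₀, hj₀⟩ := H e
  have hj₀l : j₀ = l := by
    by_contra h
    have h1 : ∑ t, T (e (j₀, t)) ≤ ∑ t, T (e (l, t)) :=
      Finset.sum_le_sum fun t _ => hrow _ _ (hl _ h) t t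
    rw [hj₀, hj₀, if_pos rfl, if_neg (Ne.symm h)] at h1
    linarith
  subst hj₀l
  have hsum : ∀ j, j ≠ l → ∑ t, T (e (j, t)) = C := fun j hj => by
    rw [hj₀, if_neg hj, add_zero]
  have hzl : z ≠ l := by
    intro h
    have := congrArg Fin.val h
    change 0 = p - 1 at this
    omega
  have hol : o ≠ l := by
    intro h
    have := congrArg Fin.val h
    change 1 = p - 1 at this
    omega
  have heq : ∀ j, z < j → j ≠ l → ∀ t, T (e (z, t)) = T (e (j, t)) := by
    intro j hzj hj t
    refine (Finset.sum_eq_sum_iff_of_le (fun t _ => hrow z j hzj t t)).1 ?_ t (Finset.mem_univ t)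
    rw [hsum z hzl, hsum j hj]
  have hz : ∀ t, T (e (z, t)) = T (e (z, t₀)) := by
    intro t
    have hzo : z < o := by simp [z, o, Fin.lt_def]
    refine le_antisymm ?_ (hcol _ _ _ (by simp [t₀, Fin.le_def]))
    rw [heq o hzo hol t₀]
    exact hrow _ _ hzo _ _
  set v := T (e (z, t₀)) with hv
  have hconst : ∀ j, j ≠ l → ∀ t, T (e (j, t)) = v := by
    intro j hj t
    by_cases hjz : j = z
    · rw [hjz, hz]
    · have hzj : z < j := by
        rw [Fin.lt_def]
        have : (j : ℕ) ≠ 0 := fun h => hjz (Fin.ext h)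
        change 0 < (j : ℕ)
        omega
      rw [← heq j hzj hj t, hz]
  have hkv : (k : ℚ) * v = C := by
    rw [← hsum z hzl, Finset.sum_congr rfl fun t _ => hz t]
    simp
  have hlast : ∀ t, T (e (l, t)) = v ∨ T (e (l, t)) = v + 1 := by
    intro t
    obtain ⟨j₁, hj₁⟩ := H ((Equiv.swap (z, t₀) (l, t)).trans e)
    have h := hj₁ z
    rw [← Finset.add_sum_erase _ _ (Finset.mem_univ t₀)] at h
    have hrest : ∑ x ∈ Finset.univ.erase t₀,
        T (((Equiv.swap (z, t₀) (l, t)).trans e) (z, x)) = (k - 1) * v := by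
      rw [Finset.sum_congr rfl (g := fun _ => v)]
      · rw [Finset.sum_const, Finset.card_erase_of_mem (Finset.mem_univ _), Finset.card_univ,
          Fintype.card_fin, nsmul_eq_mul, Nat.cast_sub hk, Nat.cast_one]
      · intro x hx
        have hx' : x ≠ t₀ := Finset.ne_of_mem_erase hx
        rw [Equiv.trans_apply, Equiv.swap_apply_of_ne_of_ne, hz]
        · simpa using hx'
        · simp [hzl]
    rw [hrest, Equiv.trans_apply, Equiv.swap_apply_left] at h
    split_ifs at h
    · right; linarith
    · left; linarith
  have hsl : ∑ t, (T (e (l, t)) - v) = 1 := by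
    rw [Finset.sum_sub_distrib, hj₀, if_pos rfl]
    simp [hkv]
  have hnn : ∀ t, 0 ≤ T (e (l, t)) - v := fun t => by
    rcases hlast t with h | h <;> rw [h] <;> simp
  obtain ⟨t₁, ht₁⟩ : ∃ t, T (e (l, t)) = v + 1 := by
    by_contra! h
    have h0 : ∑ t, (T (e (l, t)) - v) = 0 :=
      Finset.sum_eq_zero fun t _ => by rw [(hlast t).resolve_right (h t), sub_self]
    linarith
  refine ⟨e (l, t₁), v, fun i => ?_⟩
  obtain ⟨⟨j, t⟩, rfl⟩ := e.surjective i
  simp only [e.apply_eq_iff_eq, Prod.mk.injEq]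
  by_cases hj : j = l
  · subst hj
    by_cases ht : t = t₁
    · rw [if_pos ⟨rfl, ht⟩, ht, ht₁]
    · rw [if_neg (fun h => ht h.2), add_zero]
      refine (hlast t).resolve_right fun h => ?_
      have h2 := Finset.add_le_sum (s := Finset.univ) (fun t _ => hnn t)
        (Finset.mem_univ t) (Finset.mem_univ t₁) ht
      rw [hsl, h, ht₁] at h2
      linarith
  · rw [if_neg (fun h => hj h.1), add_zero, hconst j hj]

theorem zetaP_zero (p : ℕ) [NeZero p] : zetaP p 0 = 1 := by
  rw [zetaP_eq_stdAddChar, AddChar.map_zero_eq_one]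

theorem zetaP_add (p : ℕ) [NeZero p] (s t : ZMod p) :
    zetaP p (s + t) = zetaP p s * zetaP p t := by
  simp only [zetaP_eq_stdAddChar, AddChar.map_add_eq_mul]

theorem zetaP_injective (p : ℕ) [NeZero p] : Function.Injective (zetaP p) := by
  have h : zetaP p = (ZMod.stdAddChar : AddChar (ZMod p) ℂ) := funext (zetaP_eq_stdAddChar p)
  rw [h]
  exact ZMod.injective_stdAddChar

theorem zetaP_sum (p : ℕ) [NeZero p] {ι : Type*} (s : Finset ι) (f : ι → ZMod p) :
    zetaP p (∑ i ∈ s, f i) = ∏ i ∈ s, zetaP p (f i) := by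
  classical
  induction s using Finset.induction_on with
  | empty => simp [zetaP_zero]
  | insert a s ha ih => rw [Finset.sum_insert ha, Finset.prod_insert ha, zetaP_add, ih]

theorem sum_zetaP_mul (p : ℕ) [NeZero p] (b : ZMod p) :
    ∑ t : ZMod p, zetaP p (t * b) = if b = 0 then (p : ℂ) else 0 := by
  simp only [zetaP_eq_stdAddChar]
  rw [AddChar.sum_mulShift b (ZMod.isPrimitive_stdAddChar p), ZMod.card]
  push_cast
  rfl

theorem sum_zetaP (p : ℕ) [Fact p.Prime] : ∑ t : ZMod p, zetaP p t = 0 := by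
  simpa using sum_zetaP_mul p 1

theorem ip_comm {p m : ℕ} (a x : Fin m → ZMod p) : ip a x = ip x a := by
  simp only [ip, mul_comm]

theorem ip_sub {p m : ℕ} (a x y : Fin m → ZMod p) : ip a (x - y) = ip a x - ip a y := by
  simp only [ip, Pi.sub_apply, mul_sub, Finset.sum_sub_distrib]

theorem ip_smul {p m : ℕ} (u : ZMod p) (a x : Fin m → ZMod p) : ip a (u • x) = u * ip a x := by
  simp only [ip, Pi.smul_apply, smul_eq_mul, Finset.mul_sum, mul_left_comm]

theorem smul_ip {p m : ℕ} (u : ZMod p) (a x : Fin m → ZMod p) : ip (u • a) x = u * ip a x := by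
  rw [ip_comm, ip_smul, ip_comm]

theorem zero_ip {p m : ℕ} (x : Fin m → ZMod p) : ip 0 x = 0 := by
  simp [ip]

theorem eq_of_forall_ip_eq {p m : ℕ} {x y : Fin m → ZMod p}
    (h : ∀ c, c ≠ 0 → ip c x = ip c y) : x = y := by
  funext i
  have hi : ip (Pi.single i 1) x = ip (Pi.single i 1) y := by
    by_cases h0 : (Pi.single i 1 : Fin m → ZMod p) = 0
    · rw [h0, zero_ip, zero_ip]
    · exact h _ h0
  simpa [ip, Pi.single_apply] using hi

theorem sum_zetaP_ip {p m : ℕ} [NeZero p] (w : Fin m → ZMod p) :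
    ∑ c : Fin m → ZMod p, zetaP p (ip c w) = if w = 0 then (p : ℂ) ^ m else 0 := by
  have h : ∑ c : Fin m → ZMod p, zetaP p (ip c w) = ∏ i, ∑ t : ZMod p, zetaP p (t * w i) := by
    rw [Finset.prod_univ_sum, Fintype.piFinset_univ]
    simp only [ip, zetaP_sum]
  rw [h]
  simp only [sum_zetaP_mul]
  split_ifs with hw
  · simp [hw]
  · obtain ⟨i, hi⟩ := Function.ne_iff.1 hw
    exact Finset.prod_eq_zero (Finset.mem_univ i) (if_neg hi)

/-- Fourier inversion on `V_m`. -/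
theorem sum_fourier_mul_zetaP {p m : ℕ} [NeZero p] (G : (Fin m → ZMod p) → ℂ)
    (y : Fin m → ZMod p) :
    ∑ c, (∑ z, G z * zetaP p (-ip c z)) * zetaP p (ip c y) = (p : ℂ) ^ m * G y := by
  have h : ∀ z, ∑ c, G z * zetaP p (-ip c z) * zetaP p (ip c y)
      = if z = y then (p : ℂ) ^ m * G y else 0 := by
    intro z
    have h1 : ∀ c, G z * zetaP p (-ip c z) * zetaP p (ip c y) = G z * zetaP p (ip c (y - z)) := by
      intro c
      rw [mul_assoc, ← zetaP_add, ip_sub, neg_add_eq_sub]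
    simp only [h1]
    rw [← Finset.mul_sum, sum_zetaP_ip]
    by_cases hz : z = y
    · subst hz
      simp [mul_comm]
    · rw [if_neg (sub_ne_zero.2 (Ne.symm hz)), if_neg hz, mul_zero]
  simp only [Finset.sum_mul]
  rw [Finset.sum_comm]
  simp only [h]
  simp

theorem walsh_eq {p n : ℕ} [NeZero p] (f : (Fin n → ZMod p) → ZMod p) (a : Fin n → ZMod p) :
    walsh f a = ∑ x, zetaP p (f x) * zetaP p (-ip a x) := by
  simp only [walsh, sub_eq_add_neg, zetaP_add]

theorem zetaP_eq_pow (p : ℕ) [NeZero p] (t : ZMod p) : zetaP p t = zetaP p 1 ^ t.val := by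
  simp only [zetaP_eq_stdAddChar]
  rw [← AddChar.map_nsmul_eq_pow, nsmul_one, ZMod.natCast_zmod_val]

theorem isPrimitiveRoot_zetaP_one (p : ℕ) [Fact p.Prime] : IsPrimitiveRoot (zetaP p 1) p := by
  refine IsPrimitiveRoot.iff_orderOf.2 (orderOf_eq_prime ?_ ?_)
  · rw [zetaP_eq_stdAddChar, ← AddChar.map_nsmul_eq_pow]
    simp
  · rw [← zetaP_zero p]
    exact (zetaP_injective p).ne one_ne_zero

/-- The only rational linear relations between the `p`-th roots of unity are the trivial ones. -/
theorem eq_of_sum_mul_zetaP_eq_zero {p : ℕ} [Fact p.Prime] {c : ZMod p → ℚ}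
    (h : ∑ t, (c t : ℂ) * zetaP p t = 0) (t : ZMod p) : c t = c (-1) := by
  have hp := (Fact.out : p.Prime)
  let Q : Polynomial ℚ := ∑ s : ZMod p, Polynomial.monomial s.val (c s - c (-1))
  have hcoeff : ∀ s : ZMod p, Q.coeff s.val = c s - c (-1) := by
    intro s
    simp [Q,  Polynomial.coeff_monomial,
      (ZMod.val_injective p).eq_iff]
  have hQ : Polynomial.aeval (zetaP p 1) Q = 0 := by
    simp only [Q, map_sum, Polynomial.aeval_monomial, ← zetaP_eq_pow, map_sub,
      Finset.sum_sub_distrib, ← Finset.mul_sum, sum_zetaP, mul_zero, sub_zero]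
    exact h
  have hval : (-1 : ZMod p).val = p - 1 := by
    obtain ⟨q, rfl⟩ : ∃ q, p = q + 1 := ⟨p - 1, (Nat.succ_pred_prime hp).symm⟩
    exact ZMod.val_neg_one q
  have hdeg : Q.degree < (p - 1 : ℕ) := by
    rw [Polynomial.degree_lt_iff_coeff_zero]
    intro m hm
    rw [Polynomial.finsetSum_coeff]
    refine Finset.sum_eq_zero fun s _ => ?_
    rw [Polynomial.coeff_monomial]
    split_ifs with hs
    · have hs' : s = -1 := ZMod.val_injective p (by have := ZMod.val_lt s; omega)
      rw [hs', sub_self]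
    · rfl
  have hQ0 : Q = 0 := by
    by_contra hne
    have h1 := minpoly.degree_le_of_ne_zero ℚ (zetaP p 1) hne hQ
    rw [← Polynomial.cyclotomic_eq_minpoly_rat (isPrimitiveRoot_zetaP_one p) hp.pos,
      Polynomial.degree_cyclotomic, Nat.totient_prime hp] at h1
    exact absurd hdeg (not_lt.2 h1)
  have h2 := hcoeff t
  rw [hQ0, Polynomial.coeff_zero] at h2
  linarith

theorem exists_fiber_sum_eq {p : ℕ} [Fact p.Prime] {ι : Type*} [Fintype ι] (f : ι → ZMod p)
    (w : ι → ℚ) (m : ℚ) (h : ZMod p) (hsum : ∑ x, (w x : ℂ) * zetaP p (f x) = m * zetaP p h) :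
    ∃ M : ℚ, ∀ t, ∑ x with f x = t, w x = M + if t = h then m else 0 := by
  have hc : ∑ t, (((∑ x with f x = t, w x) - if t = h then m else 0 : ℚ) : ℂ) * zetaP p t = 0 := by
    simp only [Rat.cast_sub, Rat.cast_sum, apply_ite (Rat.cast : ℚ → ℂ), Rat.cast_zero, sub_mul,
      Finset.sum_sub_distrib]
    have h1 : ∑ t, (∑ x with f x = t, (w x : ℂ)) * zetaP p t = ∑ x, (w x : ℂ) * zetaP p (f x) := by
      rw [← Finset.sum_fiberwise Finset.univ f]
      refine Finset.sum_congr rfl fun t _ => ?_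
      rw [Finset.sum_mul]
      refine Finset.sum_congr rfl fun x hx => ?_
      rw [(Finset.mem_filter.1 hx).2]
    rw [h1, hsum]
    simp [ite_mul]
  refine ⟨(∑ x with f x = -1, w x) - if -1 = h then m else 0, fun t => ?_⟩
  rw [← eq_of_sum_mul_zetaP_eq_zero hc t, sub_add_cancel]

/-- The Galois action on `ℚ(ζ_p)`, applied to a sum of roots of unity. -/
theorem sum_zetaP_mul_of_sum_zetaP_eq {p : ℕ} [Fact p.Prime] {ι : Type*} [Fintype ι]
    (f : ι → ZMod p) (m : ℚ) (h : ZMod p) (hsum : ∑ x, zetaP p (f x) = m * zetaP p h)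
    {u : ZMod p} (hu : u ≠ 0) : ∑ x, zetaP p (u * f x) = m * zetaP p (u * h) := by
  obtain ⟨M, hM⟩ := exists_fiber_sum_eq f (fun _ => 1) m h (by simpa using hsum)
  have hM' : ∀ t, ((Finset.univ.filter fun x => f x = t).card : ℂ)
      = (M : ℂ) + if t = h then (m : ℂ) else 0 := by
    intro t
    have := congrArg (fun q : ℚ => (q : ℂ)) (hM t)
    simpa [apply_ite (Rat.cast : ℚ → ℂ)] using this
  have hz : ∑ t, zetaP p (u * t) = 0 := by
    simpa [mul_comm, hu] using sum_zetaP_mul p u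
  rw [← Finset.sum_fiberwise' Finset.univ f fun t => zetaP p (u * t)]
  simp only [Finset.sum_const, nsmul_eq_mul, hM', add_mul, Finset.sum_add_distrib,
    ← Finset.mul_sum, hz, ite_mul]
  simp

theorem sum_zetaP_comp_eq_zero {p : ℕ} [Fact p.Prime] {ι : Type*} [Fintype ι] (g : ι → ZMod p)
    (k : ℕ) (hg : ∀ j, (Finset.univ.filter fun i => g i = j).card = k) :
    ∑ i, zetaP p (g i) = 0 := by
  rw [← Finset.sum_fiberwise' Finset.univ g (zetaP p)]
  simp only [Finset.sum_const, hg]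
  rw [← Finset.smul_sum, sum_zetaP, smul_zero]

theorem ConditionA.weaklyRegularBent_comp {p n s : ℕ} [Fact p.Prime]
    {F : (Fin n → ZMod p) → (Fin s → ZMod p)} {ε : ℤ} (h : ConditionA p F ε)
    {g : (Fin s → ZMod p) → ZMod p} (hg : ∑ i, zetaP p (g i) = 0) :
    WeaklyRegularBent p (fun x => g (F x)) ε := by
  obtain ⟨Fd, hFd⟩ := h
  refine ⟨fun a => g (Fd a), fun a => ?_⟩
  have hp : (p : ℂ) ^ s ≠ 0 := pow_ne_zero _ (Nat.cast_ne_zero.2 (NeZero.ne p))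
  refine mul_left_cancel₀ hp ?_
  let G : (Fin s → ZMod p) → ℂ := fun c => ∑ z, zetaP p (g z) * zetaP p (-ip c z)
  have hG : ∀ y, ∑ c, G c * zetaP p (ip c y) = (p : ℂ) ^ s * zetaP p (g y) :=
    sum_fourier_mul_zetaP fun z => zetaP p (g z)
  have hG0 : G 0 = 0 := by
    simpa [G, zero_ip, zetaP_zero] using hg
  calc (p : ℂ) ^ s * walsh (fun x => g (F x)) a
      = ∑ x, (∑ c, G c * zetaP p (ip c (F x))) * zetaP p (-ip a x) := by
        simp only [walsh_eq, Finset.mul_sum, hG, mul_assoc]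
    _ = ∑ c, G c * walsh (fun x => ip c (F x)) a := by
        simp only [walsh_eq, Finset.mul_sum, Finset.sum_mul, mul_assoc]
        exact Finset.sum_comm
    _ = ∑ c, (ε : ℂ) * (p : ℂ) ^ (n / 2) * (G c * zetaP p (ip c (Fd a))) := by
        refine Finset.sum_congr rfl fun c _ => ?_
        by_cases hc : c = 0
        · simp [hc, hG0]
        · rw [hFd c hc]
          ring
    _ = (p : ℂ) ^ s * ((ε : ℂ) * (p : ℂ) ^ (n / 2) * zetaP p (g (Fd a))) := by
        rw [← Finset.mul_sum, hG]
        ring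

theorem ConditionA.map_smul {p n s : ℕ} [Fact p.Prime]
    {F : (Fin n → ZMod p) → (Fin s → ZMod p)} {ε : ℤ} (hε : ε ≠ 0) (h : ConditionA p F ε)
    {u : ZMod p} (hu : u ≠ 0) (x : Fin n → ZMod p) : F (u • x) = F x := by
  obtain ⟨Fd, hFd⟩ := h
  have hp : (p : ℂ) ≠ 0 := Nat.cast_ne_zero.2 (NeZero.ne p)
  have hm : (ε : ℂ) * (p : ℂ) ^ (n / 2) ≠ 0 :=
    mul_ne_zero (Int.cast_ne_zero.2 hε) (pow_ne_zero _ hp)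
  have hdual : ∀ a, Fd (u • a) = Fd a := by
    intro a
    refine eq_of_forall_ip_eq fun c hc => ?_
    have huc : u • c ≠ 0 := smul_ne_zero hu hc
    have h1 := sum_zetaP_mul_of_sum_zetaP_eq (fun x => ip c (F x) - ip a x)
      (ε * (p : ℚ) ^ (n / 2)) (ip c (Fd a)) (by push_cast; exact hFd c hc a) hu
    have h2 := hFd (u • c) huc (u • a)
    simp only [walsh, smul_ip, ← mul_sub] at h2
    rw [h1] at h2
    push_cast at h2
    exact (mul_left_cancel₀ hu (zetaP_injective p (mul_left_cancel₀ hm h2))).symm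
  refine eq_of_forall_ip_eq fun c hc => zetaP_injective p ?_
  refine mul_left_cancel₀ (pow_ne_zero n hp) ?_
  have hinv : ∀ y, ∑ a, walsh (fun x => ip c (F x)) a * zetaP p (ip a y)
      = (p : ℂ) ^ n * zetaP p (ip c (F y)) := by
    intro y
    simp only [walsh_eq]
    exact sum_fourier_mul_zetaP (fun x => zetaP p (ip c (F x))) y
  rw [← hinv, ← hinv]
  refine Fintype.sum_equiv (MulAction.toPerm (Units.mk0 u hu)) _ _ fun a => ?_
  change _ = walsh _ (u • a) * zetaP p (ip (u • a) x)
  rw [hFd c hc, hFd c hc, hdual, ip_smul, smul_ip]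

theorem exists_rat_eq_sum_fiber {p n : ℕ} [Fact p.Prime] {κ : Type*} [DecidableEq κ]
    {F : (Fin n → ZMod p) → κ} (hF : ∀ u : ZMod p, u ≠ 0 → ∀ x, F (u • x) = F x)
    (i : κ) (a : Fin n → ZMod p) :
    ∃ q : ℚ, ∑ x with F x = i, zetaP p (-ip a x) = q := by
  have hp := (Fact.out : p.Prime)
  set S := ∑ x with F x = i, zetaP p (-ip a x) with hS
  have hu : ∀ u : ZMod p, u ≠ 0 → ∑ x with F x = i, zetaP p (u * -ip a x) = S := by
    intro u hu
    simp only [hS, Finset.sum_filter]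
    refine Fintype.sum_equiv (MulAction.toPerm (Units.mk0 u hu)) _ _ fun x => ?_
    change _ = if F (u • x) = i then zetaP p (-ip a (u • x)) else 0
    rw [hF u hu, ip_smul, mul_neg]
  have h1 : ∑ u : ZMod p, ∑ x with F x = i, zetaP p (u * -ip a x)
      = (Finset.univ.filter fun x => F x = i).card + (p - 1) * S := by
    rw [← Finset.add_sum_erase _ _ (Finset.mem_univ (0 : ZMod p)),
      Finset.sum_congr rfl fun u h => hu u (Finset.ne_of_mem_erase h)]
    simp [zetaP_zero, Finset.card_erase_of_mem, ZMod.card, Nat.cast_sub hp.one_le]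
  have h2 : ∑ u : ZMod p, ∑ x with F x = i, zetaP p (u * -ip a x)
      = ((∑ x with F x = i, if -ip a x = 0 then (p : ℚ) else 0 : ℚ) : ℂ) := by
    rw [Finset.sum_comm]
    simp only [sum_zetaP_mul, Rat.cast_sum, apply_ite (Rat.cast : ℚ → ℂ), Rat.cast_natCast,
      Rat.cast_zero]
  have hp1 : (p : ℂ) - 1 ≠ 0 := by
    rw [sub_ne_zero]
    exact_mod_cast hp.one_lt.ne'
  refine ⟨((∑ x with F x = i, if -ip a x = 0 then (p : ℚ) else 0)
    - (Finset.univ.filter fun x => F x = i).card) / (p - 1), ?_⟩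
  rw [Rat.cast_div, Rat.cast_sub, ← h2, h1]
  push_cast
  field_simp
  ring

theorem walsh_comp_eq {p n : ℕ} [NeZero p] {κ : Type*} [Fintype κ] [DecidableEq κ]
    (F : (Fin n → ZMod p) → κ) (g : κ → ZMod p) (a : Fin n → ZMod p) :
    walsh (fun x => g (F x)) a
      = ∑ i, (∑ x with F x = i, zetaP p (-ip a x)) * zetaP p (g i) := by
  rw [walsh_eq, ← Finset.sum_fiberwise Finset.univ F]
  refine Finset.sum_congr rfl fun i _ => ?_
  rw [Finset.sum_mul]
  refine Finset.sum_congr rfl fun x hx => ?_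
  rw [(Finset.mem_filter.1 hx).2, mul_comm]

theorem exists_fiber_sum_eq_add_indicator {p n s : ℕ} [Fact p.Prime] (hodd : Odd p) (hs : 0 < s)
    {F : (Fin n → ZMod p) → (Fin s → ZMod p)} {ε : ℤ} (hε : ε ≠ 0)
    (hF : ∀ u : ZMod p, u ≠ 0 → ∀ x, F (u • x) = F x)
    (hbent : ∀ g : (Fin s → ZMod p) → ZMod p,
      (∀ j, (Finset.univ.filter fun i => g i = j).card = p ^ (s - 1)) →
        WeaklyRegularBent p (fun x => g (F x)) ε) (a : Fin n → ZMod p) :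
    ∃ (i₀ : Fin s → ZMod p) (D : ℂ), ∀ i, ∑ x with F x = i, zetaP p (-ip a x)
      = D + if i = i₀ then (ε : ℂ) * (p : ℂ) ^ (n / 2) else 0 := by
  have hp := (Fact.out : p.Prime)
  choose S hS using fun i => exists_rat_eq_sum_fiber hF i a
  let m : ℚ := ε * (p : ℚ) ^ (n / 2)
  have hm : m ≠ 0 :=
    mul_ne_zero (Int.cast_ne_zero.2 hε) (pow_ne_zero _ (Nat.cast_ne_zero.2 hp.ne_zero))
  have hp3 : 3 ≤ p := by
    have := hp.two_le
    obtain ⟨r, hr⟩ := hodd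
    omega
  have hcard : Fintype.card (Fin s → ZMod p) = p * p ^ (s - 1) := by
    rw [Fintype.card_fun, ZMod.card, Fintype.card_fin, mul_pow_sub_one hs.ne']
  obtain ⟨i₀, v, hv⟩ := exists_eq_add_indicator_of_row_sums hp3 (pow_pos hp.pos (s - 1)) hcard
    (fun i => S i / m) (((∑ i, S i) / m - 1) / p) fun e => by
      let θ : Fin p ≃ ZMod p := (ZMod.finEquiv p).toEquiv
      let g : (Fin s → ZMod p) → ZMod p := fun i => θ (e.symm i).1
      have hfib : ∀ (j : Fin p) (f : (Fin s → ZMod p) → ℚ),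
          ∑ i with g i = θ j, f i = ∑ t, f (e (j, t)) := by
        intro j f
        rw [Finset.sum_filter, ← Equiv.sum_comp e, Fintype.sum_prod_type]
        simp [g]
      have hg : ∀ j, (Finset.univ.filter fun i => g i = j).card = p ^ (s - 1) := by
        intro j
        obtain ⟨j, rfl⟩ := θ.surjective j
        have h := hfib j fun _ => 1
        simp only [Finset.sum_const, nsmul_eq_mul, mul_one, Finset.card_univ,
          Fintype.card_fin] at h
        exact_mod_cast h
      obtain ⟨fd, hfd⟩ := hbent g hg
      have h1 := hfd a
      rw [walsh_comp_eq] at h1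
      simp only [hS] at h1
      obtain ⟨M, hM⟩ := exists_fiber_sum_eq g S m (fd a) (by rw [h1]; simp [m])
      have htot : ∑ i, S i = p * M + m := by
        rw [← Finset.sum_fiberwise Finset.univ g]
        simp [hM, Finset.sum_add_distrib, ZMod.card]
      refine ⟨θ.symm (fd a), fun j => ?_⟩
      have hp0 : (p : ℚ) ≠ 0 := Nat.cast_ne_zero.2 hp.ne_zero
      rw [← Finset.sum_div, ← hfib j S, hM, htot]
      simp only [θ.eq_symm_apply]
      split_ifs <;> field_simp <;> ring
  refine ⟨i₀, (m * v : ℚ), fun i => ?_⟩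
  have h := hv i
  rw [div_eq_iff hm] at h
  rw [hS, h]
  split_ifs
  · simp only [m]
    push_cast
    ring
  · push_cast
    ring

theorem conditionA_of_bent_partition {p n s : ℕ} [Fact p.Prime] (hodd : Odd p) (hs : 0 < s)
    {F : (Fin n → ZMod p) → (Fin s → ZMod p)} {ε : ℤ} (hε : ε ≠ 0)
    (hF : ∀ u : ZMod p, u ≠ 0 → ∀ x, F (u • x) = F x)
    (hbent : ∀ g : (Fin s → ZMod p) → ZMod p,
      (∀ j, (Finset.univ.filter fun i => g i = j).card = p ^ (s - 1)) →
        WeaklyRegularBent p (fun x => g (F x)) ε) :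
    ConditionA p F ε := by
  choose Fd D hD using exists_fiber_sum_eq_add_indicator hodd hs hε hF hbent
  refine ⟨Fd, fun c hc a => ?_⟩
  have h0 : ∑ i, zetaP p (ip c i) = 0 := by
    simp only [ip_comm c]
    rw [sum_zetaP_ip, if_neg hc]
  rw [walsh_comp_eq]
  simp only [hD, add_mul, Finset.sum_add_distrib]
  rw [← Finset.mul_sum, h0]
  simp [ite_mul]

theorem stmt9 (p : ℕ) [Fact p.Prime] (hodd : Odd p) (n s : ℕ) (hn : 0 < n) (hneven : Even n)
    (hs : 0 < s) (hsn : s ≤ n / 2) (ε : ℤ) (hε : ε = 1 ∨ ε = -1)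
    -- a partition of `V_n` into nonempty sets `A i`, with `F x = i ↔ x ∈ A i`
    (A : (Fin s → ZMod p) → Set (Fin n → ZMod p))
    (hA : ∀ i, (A i).Nonempty)
    (F : (Fin n → ZMod p) → (Fin s → ZMod p))
    (hFA : ∀ x i, F x = i ↔ x ∈ A i) :
    -- the partition is a bent partition satisfying Condition C with sign ε
    ((∀ (a : (ZMod p)ˣ) (i : Fin s → ZMod p),
        (fun x => (a : ZMod p) • x) '' A i = A i) ∧
      ∀ g : (Fin s → ZMod p) → ZMod p,
        (∀ j : ZMod p, (Finset.univ.filter (fun i => g i = j)).card = p ^ (s - 1)) →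
        WeaklyRegularBent p (fun x => g (F x)) ε)
    -- if and only if `F` is vectorial dual-bent satisfying Condition A with sign ε
    ↔ ConditionA p F ε := by

  have hε0 : ε ≠ 0 := by rcases hε with rfl | rfl <;> decide
  constructor
  · rintro ⟨hsmul, hbent⟩
    refine conditionA_of_bent_partition hodd hs hε0 (fun u hu x => ?_) hbent
    rw [hFA, ← hsmul (Units.mk0 u hu) (F x)]
    exact ⟨x, (hFA x _).1 rfl, rfl⟩
  · intro h
    refine ⟨fun u i => ?_, fun g hg => h.weaklyRegularBent_comp (sum_zetaP_comp_eq_zero g _ hg)⟩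
    have hmem : ∀ w : (ZMod p)ˣ, ∀ x, x ∈ A i → (w : ZMod p) • x ∈ A i := by
      intro w x hx
      rw [← hFA] at hx ⊢
      rw [h.map_smul hε0 w.ne_zero, hx]
    refine Set.Subset.antisymm (Set.image_subset_iff.2 fun x hx => hmem u x hx) fun x hx => ?_
    refine ⟨((u⁻¹ : (ZMod p)ˣ) : ZMod p) • x, hmem u⁻¹ x hx, ?_⟩
    change (u : ZMod p) • ((u⁻¹ : (ZMod p)ˣ) : ZMod p) • x = x
    rw [smul_smul, Units.mul_inv, one_smul]
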